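/- Let p be a prime, f a polynomial with coefficients in ℤ_p, and n ≥ 1. Suppose the induced map f_/n on ℤ/pⁿℤ is minimal (every forward orbit of f_/n is all of ℤ/pⁿℤ). Then the following are equivalent: (1) the induced map f_/(n+1) on ℤ/pⁿ⁺¹ℤ is minimal; (2) for all x ∈ ℤ_p, f^(pⁿ)(x) − x ∉ pⁿ⁺¹ℤ_p and (f^(pⁿ))′(x) ∈ 1 + pℤ_p; (3) there exists x ∈ ℤ_p with f^(pⁿ)(x) − x ∉ pⁿ⁺¹ℤ_p and (f^(pⁿ))′(x) ∈ 1 + pℤ_p. Here f^(pⁿ) denotes the pⁿ-fold composition of f with itself (a polynomial over ℤ_p) and (f^(pⁿ))′ its formal derivative. -/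

import Mathlib

open Polynomial

/-- A transitive self-map of a finite type is a single cycle. -/
theorem Function.minimalPeriod_eq_card_of_transitive {α : Type*} [Fintype α] {T : α → α}
    (h : ∀ x y, ∃ k : ℕ, T^[k] x = y) (x : α) :
    Function.minimalPeriod T x = Fintype.card α := by
  have hpos : 0 < minimalPeriod T x := by
    obtain ⟨k, hk⟩ := h (T x) x
    exact IsPeriodicPt.minimalPeriod_pos (n := k + 1) k.succ_pos hk
  have hbij : Function.Bijective (fun i : Fin (minimalPeriod T x) => T^[i] x) := by
    constructor
    · intro i j hij
      exact Fin.ext (iterate_injOn_Iio_minimalPeriod i.2 j.2 hij)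
    · intro y
      obtain ⟨k, rfl⟩ := h x y
      exact ⟨⟨k % _, Nat.mod_lt _ hpos⟩, iterate_mod_minimalPeriod_eq⟩
  simpa using Fintype.card_of_bijective hbij

namespace Polynomial

variable {R : Type*} [CommRing R] (f : R[X])

theorem iterate_comp_right_add (a b : ℕ) :
    (fun q : R[X] => q.comp f)^[a + b] X =
      ((fun q : R[X] => q.comp f)^[a] X).comp ((fun q : R[X] => q.comp f)^[b] X) := by
  induction b with
  | zero => simp
  | succ b ih =>
    rw [← add_assoc, Function.iterate_succ_apply', ih, Function.iterate_succ_apply', comp_assoc]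

theorem eval_iterate_comp_right (k : ℕ) (x : R) :
    ((fun q : R[X] => q.comp f)^[k] X).eval x = (fun z => f.eval z)^[k] x := by
  induction k generalizing x with
  | zero => simp
  | succ k ih => rw [Function.iterate_succ_apply', eval_comp, ih, Function.iterate_succ_apply]

/-- First-order expansion modulo `π ^ (n + 1)` of a polynomial along `π ^ n`. -/
theorem pow_succ_dvd_eval_add_sub (g : R[X]) (π x t : R) {n : ℕ} (hn : 1 ≤ n) :
    π ^ (n + 1) ∣ g.eval (x + π ^ n * t) - (g.eval x + π ^ n * (g.derivative.eval x * t)) := by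
  obtain ⟨k, hk⟩ := g.binomExpansion x (π ^ n * t)
  obtain ⟨m, rfl⟩ := Nat.exists_eq_add_of_le hn
  exact ⟨k * t ^ 2 * π ^ m, by rw [hk]; ring⟩

end Polynomial

namespace PadicInt

variable {p : ℕ} [Fact p.Prime]

theorem toZModPow_eq_iff_dvd_sub (m : ℕ) (x y : ℤ_[p]) :
    toZModPow m x = toZModPow m y ↔ (p : ℤ_[p]) ^ m ∣ x - y := by
  rw [← sub_eq_zero, ← map_sub, ← RingHom.mem_ker, ker_toZModPow, Ideal.mem_span_singleton]

theorem toZModPow_surjective (m : ℕ) : Function.Surjective (toZModPow (p := p) m) := fun z => by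
  have : NeZero (p ^ m) := ⟨pow_ne_zero _ (Fact.out : p.Prime).ne_zero⟩
  exact ⟨(z.val : ℤ_[p]), by simp⟩

theorem exists_nat_dvd_add_mul {u : ℤ_[p]} (hu : ¬ (p : ℤ_[p]) ∣ u) (v : ℤ_[p]) :
    ∃ j : ℕ, (p : ℤ_[p]) ∣ v + u * j := by
  have hunit : IsUnit u := by
    rw [isUnit_iff]
    exact le_antisymm (norm_le_one u) (not_lt.1 fun h => hu ((norm_lt_one_iff_dvd u).1 h))
  obtain ⟨w, hw⟩ := hunit.exists_right_inv
  have h := sub_zmodRepr_mem (-v * w)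
  rw [maximalIdeal_eq_span_p, Ideal.mem_span_singleton] at h
  obtain ⟨s, hs⟩ := h
  exact ⟨zmodRepr (-v * w), -(u * s), by linear_combination (-u) * hs - v * hw⟩

variable (f : ℤ_[p][X])

theorem toZModPow_iterate_eval (m k : ℕ) (x : ℤ_[p]) :
    toZModPow m ((fun z => f.eval z)^[k] x) =
      (fun z => (f.map (toZModPow m)).eval z)^[k] (toZModPow m x) :=
  Function.Semiconj.iterate_right (f := toZModPow m) (fun z => by simp [eval_map_apply]) k x

/-- Minimality of the reduction of `f` modulo `p ^ m`, in terms of orbits in `ℤ_[p]`. -/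
theorem transitive_toZModPow_iff (m : ℕ) :
    (∀ x y : ZMod (p ^ m), ∃ k : ℕ, (fun z => (f.map (toZModPow m)).eval z)^[k] x = y) ↔
      ∀ x y : ℤ_[p], ∃ k : ℕ, (p : ℤ_[p]) ^ m ∣ (fun z => f.eval z)^[k] x - y := by
  simp_rw [(toZModPow_surjective m).forall, ← toZModPow_iterate_eval, toZModPow_eq_iff_dvd_sub]

theorem pow_dvd_iterate_sub_self_iff {m : ℕ}
    (h : ∀ x y : ZMod (p ^ m), ∃ k : ℕ, (fun z => (f.map (toZModPow m)).eval z)^[k] x = y)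
    (k : ℕ) (x : ℤ_[p]) :
    (p : ℤ_[p]) ^ m ∣ (fun z => f.eval z)^[k] x - x ↔ p ^ m ∣ k := by
  have : NeZero (p ^ m) := ⟨pow_ne_zero _ (Fact.out : p.Prime).ne_zero⟩
  rw [← toZModPow_eq_iff_dvd_sub, toZModPow_iterate_eval]
  have hc := Function.minimalPeriod_eq_card_of_transitive h (toZModPow m x)
  rw [ZMod.card] at hc
  exact Function.isPeriodicPt_iff_minimalPeriod_dvd.trans (by rw [hc])

theorem exists_lt_pow_dvd_iterate_sub {m : ℕ}
    (h : ∀ x y : ZMod (p ^ m), ∃ k : ℕ, (fun z => (f.map (toZModPow m)).eval z)^[k] x = y)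
    (x y : ℤ_[p]) :
    ∃ k < p ^ m, (p : ℤ_[p]) ^ m ∣ (fun z => f.eval z)^[k] x - y := by
  have : NeZero (p ^ m) := ⟨pow_ne_zero _ (Fact.out : p.Prime).ne_zero⟩
  have hc := Function.minimalPeriod_eq_card_of_transitive h (toZModPow m x)
  rw [ZMod.card] at hc
  obtain ⟨k, hk⟩ := h (toZModPow m x) (toZModPow m y)
  refine ⟨k % p ^ m, Nat.mod_lt _ (NeZero.pos _), ?_⟩
  rw [← toZModPow_eq_iff_dvd_sub, toZModPow_iterate_eval, ← hk]
  exact Function.IsPeriodicPt.iterate_mod_apply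
    (Function.isPeriodicPt_iff_minimalPeriod_dvd.2 (by rw [hc])) k

/-- If every point is reached from a periodic point `x` modulo `p ^ m`, then `f` is transitive
modulo `p ^ m`. -/
theorem transitive_of_forall_reachable {m N : ℕ} {x : ℤ_[p]} (hN : 1 ≤ N)
    (hper : (p : ℤ_[p]) ^ m ∣ (fun z => f.eval z)^[N] x - x)
    (hx : ∀ y : ℤ_[p], ∃ k : ℕ, (p : ℤ_[p]) ^ m ∣ (fun z => f.eval z)^[k] x - y) :
    ∀ x y : ZMod (p ^ m), ∃ k : ℕ, (fun z => (f.map (toZModPow m)).eval z)^[k] x = y := by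
  rw [← toZModPow_eq_iff_dvd_sub, toZModPow_iterate_eval] at hper
  simp_rw [← toZModPow_eq_iff_dvd_sub, toZModPow_iterate_eval] at hx
  rw [← (toZModPow_surjective m).forall
    (p := fun y => ∃ k : ℕ, (fun z => (f.map (toZModPow m)).eval z)^[k] (toZModPow m x) = y)] at hx
  intro u y
  obtain ⟨i, rfl⟩ := hx u
  obtain ⟨l, rfl⟩ := hx y
  refine ⟨l + i * (N - 1), ?_⟩
  have hi : l + i * (N - 1) + i = l + N * i := by
    obtain ⟨M, rfl⟩ := Nat.exists_eq_add_of_le hN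
    simp only [Nat.add_sub_cancel_left]
    ring
  rw [← Function.iterate_add_apply, hi, Function.iterate_add_apply]
  congr 1
  exact (show Function.IsPeriodicPt _ N _ from hper).mul_const i

end PadicInt

open PadicInt in
/-- Minimality modulo `p ^ (n + 1)` forces the derivative and displacement conditions. -/
theorem not_dvd_and_dvd_of_transitive {p : ℕ} [Fact p.Prime] (f : ℤ_[p][X]) {n : ℕ} (hn : 1 ≤ n)
    (hmin : ∀ x y : ZMod (p ^ n), ∃ k : ℕ, (fun z => (f.map (toZModPow n)).eval z)^[k] x = y)
    (hmin' : ∀ x y : ZMod (p ^ (n + 1)),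
      ∃ k : ℕ, (fun z => (f.map (toZModPow (n + 1))).eval z)^[k] x = y) (x : ℤ_[p]) :
    ¬ (p : ℤ_[p]) ^ (n + 1) ∣ ((fun q : ℤ_[p][X] => q.comp f)^[p ^ n] X).eval x - x ∧
      (p : ℤ_[p]) ∣ (derivative ((fun q : ℤ_[p][X] => q.comp f)^[p ^ n] X)).eval x - 1 := by
  have hp : p.Prime := Fact.out
  have key (y : ℤ_[p]) :
      ¬ (p : ℤ_[p]) ^ (n + 1) ∣ ((fun q : ℤ_[p][X] => q.comp f)^[p ^ n] X).eval y - y := by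
    rw [eval_iterate_comp_right, pow_dvd_iterate_sub_self_iff f hmin',
      Nat.pow_dvd_pow_iff_le_right hp.one_lt]
    omega
  refine ⟨key x, ?_⟩
  by_contra ha
  obtain ⟨b, hb⟩ := (pow_dvd_iterate_sub_self_iff f hmin (p ^ n) x).2 dvd_rfl
  rw [← eval_iterate_comp_right] at hb
  obtain ⟨j, s, hs⟩ := exists_nat_dvd_add_mul ha b
  obtain ⟨k, hk⟩ := pow_succ_dvd_eval_add_sub
    ((fun q : ℤ_[p][X] => q.comp f)^[p ^ n] X) (p : ℤ_[p]) x j hn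
  exact key (x + p ^ n * j) ⟨k + s, by linear_combination hk + hb + (p : ℤ_[p]) ^ n * hs⟩

open PadicInt in
/-- The displacement and derivative conditions at one point imply minimality modulo
`p ^ (n + 1)`. -/
theorem transitive_of_not_dvd_of_dvd {p : ℕ} [Fact p.Prime] (f : ℤ_[p][X]) {n : ℕ} (hn : 1 ≤ n)
    (hmin : ∀ x y : ZMod (p ^ n), ∃ k : ℕ, (fun z => (f.map (toZModPow n)).eval z)^[k] x = y)
    {x : ℤ_[p]}
    (hx : ¬ (p : ℤ_[p]) ^ (n + 1) ∣ ((fun q : ℤ_[p][X] => q.comp f)^[p ^ n] X).eval x - x)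
    (hd : (p : ℤ_[p]) ∣ (derivative ((fun q : ℤ_[p][X] => q.comp f)^[p ^ n] X)).eval x - 1) :
    ∀ x y : ZMod (p ^ (n + 1)),
      ∃ k : ℕ, (fun z => (f.map (toZModPow (n + 1))).eval z)^[k] x = y := by
  have hp : Prime (p : ℤ_[p]) := prime_p
  obtain ⟨b, hb⟩ := (pow_dvd_iterate_sub_self_iff f hmin (p ^ n) x).2 dvd_rfl
  have hpb : ¬ (p : ℤ_[p]) ∣ b := by
    rintro ⟨c, rfl⟩
    exact hx ⟨c, by rw [eval_iterate_comp_right, hb]; ring⟩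
  have hiter (j : ℕ) : ∃ s, (fun z => f.eval z)^[p ^ n * j] x =
      x + (p : ℤ_[p]) ^ n * (j * b + p * s) := by
    induction j with
    | zero => exact ⟨0, by simp⟩
    | succ j ih =>
      obtain ⟨s, hs⟩ := ih
      obtain ⟨d, hd⟩ := hd
      obtain ⟨k, hk⟩ := pow_succ_dvd_eval_add_sub
        ((fun q : ℤ_[p][X] => q.comp f)^[p ^ n] X) (p : ℤ_[p]) x (j * b + p * s) hn
      rw [eval_iterate_comp_right, eval_iterate_comp_right] at hk
      refine ⟨k + d * (j * b + p * s) + s, ?_⟩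
      rw [Nat.mul_succ, Nat.add_comm, Function.iterate_add_apply, hs]
      push_cast
      linear_combination hk + hb + (p : ℤ_[p]) ^ n * (j * b + p * s) * hd
  refine transitive_of_forall_reachable f (N := p ^ n * p) (x := x)
    (Nat.mul_pos (pow_pos (Fact.out : p.Prime).pos n) (Fact.out : p.Prime).pos) ?_ fun y => ?_
  · obtain ⟨s, hs⟩ := hiter p
    exact ⟨b + s, by rw [hs]; ring⟩
  · obtain ⟨i, hi, c, hc⟩ := exists_lt_pow_dvd_iterate_sub f hmin x y
    have hunit : ¬ (p : ℤ_[p]) ∣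
        (derivative ((fun q : ℤ_[p][X] => q.comp f)^[i] X)).eval x := by
      intro h
      rw [← Nat.sub_add_cancel hi.le, iterate_comp_right_add, derivative_comp, eval_mul] at hd
      exact hp.not_isUnit (isUnit_of_dvd_one ((dvd_sub_right (h.mul_right _)).1 hd))
    obtain ⟨j, t, ht⟩ := exists_nat_dvd_add_mul (hp.not_dvd_mul hunit hpb) c
    obtain ⟨s, hs⟩ := hiter j
    obtain ⟨k, hk⟩ := pow_succ_dvd_eval_add_sub
      ((fun q : ℤ_[p][X] => q.comp f)^[i] X) (p : ℤ_[p]) x (j * b + p * s) hn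
    simp only [eval_iterate_comp_right] at hk
    refine ⟨i + p ^ n * j,
      k + t + (derivative ((fun q : ℤ_[p][X] => q.comp f)^[i] X)).eval x * s, ?_⟩
    rw [Function.iterate_add_apply, hs]
    linear_combination hk + hc + (p : ℤ_[p]) ^ n * ht

/-- Let `f` be a polynomial over `ℤ_[p]`, `n ≥ 1`, and suppose the induced map on
`ℤ/pⁿℤ` is minimal.  Then minimality of the induced map on `ℤ/pⁿ⁺¹ℤ` is equivalent to:
for all `x` (equivalently, for some `x`), `f^(pⁿ)(x) - x ∉ pⁿ⁺¹ℤ_p` and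
`(f^(pⁿ))′(x) ∈ 1 + pℤ_p`, where `f^(pⁿ)` is the `pⁿ`-fold composition of `f`. -/
theorem stmt_2 (p : ℕ) [Fact p.Prime] (f : Polynomial ℤ_[p]) (n : ℕ) (hn : 1 ≤ n)
    (hmin : ∀ x y : ZMod (p ^ n),
      ∃ k : ℕ, (fun z : ZMod (p ^ n) => (f.map (PadicInt.toZModPow n)).eval z)^[k] x = y) :
    ((∀ x y : ZMod (p ^ (n + 1)),
        ∃ k : ℕ,
          (fun z : ZMod (p ^ (n + 1)) =>
            (f.map (PadicInt.toZModPow (n + 1))).eval z)^[k] x = y) ↔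
      (∀ x : ℤ_[p],
        ¬ (p : ℤ_[p]) ^ (n + 1) ∣ (((fun q : Polynomial ℤ_[p] => q.comp f)^[p ^ n] X).eval x - x) ∧
          (p : ℤ_[p]) ∣
            ((derivative ((fun q : Polynomial ℤ_[p] => q.comp f)^[p ^ n] X)).eval x - 1))) ∧
    ((∀ x y : ZMod (p ^ (n + 1)),
        ∃ k : ℕ,
          (fun z : ZMod (p ^ (n + 1)) =>
            (f.map (PadicInt.toZModPow (n + 1))).eval z)^[k] x = y) ↔
      (∃ x : ℤ_[p],
        ¬ (p : ℤ_[p]) ^ (n + 1) ∣ (((fun q : Polynomial ℤ_[p] => q.comp f)^[p ^ n] X).eval x - x) ∧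
          (p : ℤ_[p]) ∣
            ((derivative ((fun q : Polynomial ℤ_[p] => q.comp f)^[p ^ n] X)).eval x - 1))) := by
  have hall := not_dvd_and_dvd_of_transitive f hn hmin
  exact ⟨⟨hall, fun h => transitive_of_not_dvd_of_dvd f hn hmin (h 0).1 (h 0).2⟩,
    ⟨fun h => ⟨0, hall h 0⟩, fun ⟨_, hx, hd⟩ => transitive_of_not_dvd_of_dvd f hn hmin hx hd⟩⟩
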